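/- For chip-firing on the line starting from c₀ with 6 chips at the origin (c₀(0)=6, c₀(i)=0 otherwise), the configuration poset is a distributive lattice. -/

import Mathlib

/-!  Chip-firing on the line (the 1-dimensional grid ℤ). -/

/-- One chip-firing move at site `k` on the line: site `k` loses two chips and each of
its two neighbors gains one chip. -/
def lfire (c : ℤ → ℕ) (k : ℤ) : ℤ → ℕ :=
  fun i => if i = k then c k - 2 else if i = k - 1 ∨ i = k + 1 then c i + 1 else c i

/-- Apply a list of firing moves in order. -/
def lapply (c : ℤ → ℕ) : List ℤ → (ℤ → ℕ)
  | [] => c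
  | k :: s => lapply (lfire c k) s

/-- The list of sites `s` is a legal firing sequence from `c`: every fired site has
at least 2 chips at the moment it is fired. -/
def LLegal (c : ℤ → ℕ) : List ℤ → Prop
  | [] => True
  | k :: s => 2 ≤ c k ∧ LLegal (lfire c k) s

/-- `c₂` is reachable from `c₁` by a sequence of firing moves. -/
def LReachable (c₁ c₂ : ℤ → ℕ) : Prop :=
  ∃ s, LLegal c₁ s ∧ lapply c₁ s = c₂

/-- No site is ready to fire in `c`. -/
def LStable (c : ℤ → ℕ) : Prop := ∀ k, c k < 2

/-- The set `mv` of moves performed by the firing sequence `s`: the pair `(k, j)`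
denotes the `j`-th firing at site `k`. -/
def Mv (s : List ℤ) : Set (ℤ × ℕ) := {p | 1 ≤ p.2 ∧ p.2 ≤ s.count p.1}

/-- Some legal firing sequence from `c₀` performs the `j'`-th firing at `k'` strictly
before the `j`-th firing at `k`: there is a legal sequence with a prefix `t` containing
exactly `j' - 1` firings at `k'` and fewer than `j` firings at `k`, immediately followed
by a firing at `k'`. -/
def LFiresBefore (c₀ : ℤ → ℕ) (k' : ℤ) (j' : ℕ) (k : ℤ) (j : ℕ) : Prop :=
  ∃ t u : List ℤ, LLegal c₀ (t ++ k' :: u) ∧ t.count k' = j' - 1 ∧ t.count k < j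

/-- The move-poset order: move `p = (k, j)` (the `j`-th firing at `k`) satisfies `p ≥ q`
iff `p = q` or no legal firing sequence from `c₀` performs move `q` strictly before `p`. -/
def LMoveGE (c₀ : ℤ → ℕ) (p q : ℤ × ℕ) : Prop :=
  p = q ∨ ¬ LFiresBefore c₀ q.1 q.2 p.1 p.2

/-- The endgame configuration with `n = 2m` chips: two chips at the origin and one chip
at each site `i` with `1 ≤ |i| ≤ m - 1`. -/
def endgame (m : ℕ) : ℤ → ℕ :=
  fun i => if i = 0 then 2 else if |i| ≤ (m : ℤ) - 1 then 1 else 0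

/-- `j` is the join (least upper bound) of `a` and `b` in the configuration poset of
configurations reachable from `c₀`, ordered by `c ≥ c'` iff `c'` is reachable from `c`. -/
def LIsJoin (c₀ a b j : ℤ → ℕ) : Prop :=
  LReachable c₀ j ∧ LReachable j a ∧ LReachable j b ∧
    ∀ c, LReachable c₀ c → LReachable c a → LReachable c b → LReachable c j

/-- `mt` is the meet (greatest lower bound) of `a` and `b` in the configuration poset of
configurations reachable from `c₀`, ordered by `c ≥ c'` iff `c'` is reachable from `c`. -/
def LIsMeet (c₀ a b mt : ℤ → ℕ) : Prop :=
  LReachable c₀ mt ∧ LReachable a mt ∧ LReachable b mt ∧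
    ∀ c, LReachable c₀ c → LReachable a c → LReachable b c → LReachable mt c

/-- The precedence constraints between the numbers `a`, `b`, `d` of firings at the origin and at
the first and second site on one side of it, when six chips start at the origin. -/
def HalfOdometer (a b d : ℕ) : Prop :=
  a ≤ 6 ∧ b ≤ 3 ∧ d ≤ 1 ∧ (1 ≤ b → 2 ≤ a) ∧ (2 ≤ b → 4 ≤ a) ∧ (3 ≤ b → 5 ≤ a) ∧
    (3 ≤ b → 1 ≤ d) ∧ (1 ≤ d → 2 ≤ b) ∧ (4 ≤ a → 1 ≤ b) ∧ (5 ≤ a → 2 ≤ b) ∧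
    (6 ≤ a → 3 ≤ b)

/-- The firing-count vectors of legal firing sequences starting from six chips at the origin. -/
def SixOdometer (u : ℤ → ℕ) : Prop :=
  (∀ i, i < -2 ∨ 2 < i → u i = 0) ∧ HalfOdometer (u 0) (u 1) (u 2) ∧
    HalfOdometer (u 0) (u (-1)) (u (-2))

/-- The configuration obtained from six chips at the origin when each site `i` has fired
`u i` times. -/
def sixConf (u : ℤ → ℕ) : ℤ → ℕ :=
  fun i => (if i = 0 then 6 else 0) + u (i - 1) + u (i + 1) - 2 * u i

theorem le_sup_imp {α β : Type*} [LinearOrder α] [LinearOrder β] {p a a' : α} {q b b' : β}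
    (h : p ≤ a → q ≤ b) (h' : p ≤ a' → q ≤ b') (hp : p ≤ a ⊔ a') : q ≤ b ⊔ b' :=
  le_sup_iff.2 ((le_sup_iff.1 hp).imp h h')

theorem le_inf_imp {α β : Type*} [SemilatticeInf α] [SemilatticeInf β] {p a a' : α} {q b b' : β}
    (h : p ≤ a → q ≤ b) (h' : p ≤ a' → q ≤ b') (hp : p ≤ a ⊓ a') : q ≤ b ⊓ b' :=
  le_inf (h (le_inf_iff.1 hp).1) (h' (le_inf_iff.1 hp).2)

namespace HalfOdometer

theorem sup {a b d a' b' d' : ℕ} (h : HalfOdometer a b d) (h' : HalfOdometer a' b' d') :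
    HalfOdometer (a ⊔ a') (b ⊔ b') (d ⊔ d') := by
  obtain ⟨h₁, h₂, h₃, h₄, h₅, h₆, h₇, h₈, h₉, h₁₀, h₁₁⟩ := h
  obtain ⟨g₁, g₂, g₃, g₄, g₅, g₆, g₇, g₈, g₉, g₁₀, g₁₁⟩ := h'
  exact ⟨sup_le h₁ g₁, sup_le h₂ g₂, sup_le h₃ g₃, le_sup_imp h₄ g₄,
    le_sup_imp h₅ g₅, le_sup_imp h₆ g₆, le_sup_imp h₇ g₇, le_sup_imp h₈ g₈,
    le_sup_imp h₉ g₉, le_sup_imp h₁₀ g₁₀, le_sup_imp h₁₁ g₁₁⟩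

theorem inf {a b d a' b' d' : ℕ} (h : HalfOdometer a b d) (h' : HalfOdometer a' b' d') :
    HalfOdometer (a ⊓ a') (b ⊓ b') (d ⊓ d') := by
  obtain ⟨h₁, h₂, h₃, h₄, h₅, h₆, h₇, h₈, h₉, h₁₀, h₁₁⟩ := h
  obtain ⟨g₁, g₂, g₃, g₄, g₅, g₆, g₇, g₈, g₉, g₁₀, g₁₁⟩ := h'
  exact ⟨inf_le_of_left_le h₁, inf_le_of_left_le h₂, inf_le_of_left_le h₃, le_inf_imp h₄ g₄,
    le_inf_imp h₅ g₅, le_inf_imp h₆ g₆, le_inf_imp h₇ g₇, le_inf_imp h₈ g₈,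
    le_inf_imp h₉ g₉, le_inf_imp h₁₀ g₁₀, le_inf_imp h₁₁ g₁₁⟩

theorem exists_pred {a b d : ℕ} (h : HalfOdometer a b d) :
    (1 ≤ b ∧ HalfOdometer a (b - 1) d) ∨ (1 ≤ d ∧ HalfOdometer a b (d - 1)) ∨
      HalfOdometer (a - 1) b d := by
  have ha := h.1
  have hb := h.2.1
  have hd := h.2.2.1
  interval_cases a <;> interval_cases b <;> interval_cases d <;> simp [HalfOdometer] at h ⊢

end HalfOdometer

theorem int_mem_window_or_outside (i : ℤ) :
    i = -2 ∨ i = -1 ∨ i = 0 ∨ i = 1 ∨ i = 2 ∨ (i < -2 ∨ 2 < i) := by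
  omega

namespace SixOdometer

theorem zero : SixOdometer 0 := by
  simp [SixOdometer, HalfOdometer]

theorem sup {u v : ℤ → ℕ} (hu : SixOdometer u) (hv : SixOdometer v) : SixOdometer (u ⊔ v) := by
  obtain ⟨hu, hu₁, hu₂⟩ := hu
  obtain ⟨hv, hv₁, hv₂⟩ := hv
  refine ⟨fun i hi => by simp [hu i hi, hv i hi], hu₁.sup hv₁, hu₂.sup hv₂⟩

theorem inf {u v : ℤ → ℕ} (hu : SixOdometer u) (hv : SixOdometer v) : SixOdometer (u ⊓ v) := by
  obtain ⟨hu, hu₁, hu₂⟩ := hu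
  obtain ⟨hv, hv₁, hv₂⟩ := hv
  refine ⟨fun i hi => by simp [hu i hi], hu₁.inf hv₁, hu₂.inf hv₂⟩

theorem two_mul_le {u : ℤ → ℕ} (hu : SixOdometer u) (i : ℤ) :
    2 * u i ≤ (if i = 0 then 6 else 0) + u (i - 1) + u (i + 1) := by
  obtain ⟨h₀, h₁, h₂⟩ := hu
  simp only [HalfOdometer] at h₁ h₂
  rcases int_mem_window_or_outside i with rfl | rfl | rfl | rfl | rfl | hi
  · norm_num; omega
  · norm_num; omega
  · norm_num; omega
  · norm_num; omega
  · norm_num; omega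
  · simp [h₀ i hi]

theorem add_single {u : ℤ → ℕ} (hu : SixOdometer u) {k : ℤ} (hk : 2 ≤ sixConf u k) :
    SixOdometer (u + Pi.single k 1) := by
  obtain ⟨h₀, h₁, h₂⟩ := hu
  simp only [HalfOdometer] at h₁ h₂
  have h₃ := h₀ 3 (by norm_num)
  have h₃' := h₀ (-3) (by norm_num)
  unfold sixConf at hk
  have hk' : -2 ≤ k ∧ k ≤ 2 := by
    by_contra hcon
    have hout : k < -2 ∨ 2 < k := by omega
    have hk0 : k ≠ 0 := by omega
    rw [if_neg hk0, h₀ k hout] at hk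
    by_cases hk3 : k = 3
    · subst hk3; norm_num [h₀ 4] at hk; omega
    · by_cases hk3' : k = -3
      · subst hk3'; norm_num [h₀ (-4)] at hk; omega
      · rw [h₀ (k - 1) (by omega), h₀ (k + 1) (by omega)] at hk
        omega
  refine ⟨fun i hi => ?_, ?_⟩
  · rw [Pi.add_apply, h₀ i hi, Pi.single_eq_of_ne (by omega), add_zero]
  · obtain ⟨hl, hr⟩ := hk'
    interval_cases k <;> norm_num at hk <;>
      simp only [HalfOdometer, Pi.add_apply, Pi.single_apply] <;> norm_num <;> omega

theorem exists_eq_add_single {u : ℤ → ℕ} (hu : SixOdometer u) (hne : u ≠ 0) :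
    ∃ v k, SixOdometer v ∧ u = v + Pi.single k 1 := by
  suffices h : ∃ k, 1 ≤ u k ∧ SixOdometer (u - Pi.single k 1 : ℤ → ℕ) by
    obtain ⟨k, hk, h⟩ := h
    refine ⟨_, k, h, (tsub_add_cancel_of_le fun i => ?_).symm⟩
    rw [Pi.single_apply]
    split_ifs with hi
    · rwa [hi]
    · exact Nat.zero_le _
  obtain ⟨h₀, h₁, h₂⟩ := hu
  let w (k : ℤ) : ℤ → ℕ := u - Pi.single k 1
  have key : ∀ k, 1 ≤ u k → HalfOdometer (w k 0) (w k 1) (w k 2) ∧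
      HalfOdometer (w k 0) (w k (-1)) (w k (-2)) →
      ∃ k, 1 ≤ u k ∧ SixOdometer (u - Pi.single k 1) :=
    fun k hk h => ⟨k, hk, fun i hi => by simp [h₀ i hi], h⟩
  have hpos : 1 ≤ u 0 := by
    by_contra hcon
    simp only [HalfOdometer] at h₁ h₂
    refine hne (funext fun i => ?_)
    rcases int_mem_window_or_outside i with rfl | rfl | rfl | rfl | rfl | hi
    any_goals simp only [Pi.zero_apply]; omega
    exact h₀ i hi
  simp only [w, Pi.sub_apply, Pi.single_apply] at key
  rcases h₁.exists_pred with ⟨hb, h⟩ | ⟨hd, h⟩ | h₁'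
  · exact key 1 hb (by simpa using ⟨h, h₂⟩)
  · exact key 2 hd (by simpa using ⟨h, h₂⟩)
  rcases h₂.exists_pred with ⟨hb, h⟩ | ⟨hd, h⟩ | h₂'
  · exact key (-1) hb (by simpa using ⟨h₁, h⟩)
  · exact key (-2) hd (by simpa using ⟨h₁, h⟩)
  · exact key 0 hpos (by simpa using ⟨h₁', h₂'⟩)

theorem eq_of_sixConf_eq {u v : ℤ → ℕ} (hu : SixOdometer u) (hv : SixOdometer v)
    (h : sixConf u = sixConf v) : u = v := by
  have eqn (i : ℤ) : u (i - 1) + u (i + 1) + 2 * v i = v (i - 1) + v (i + 1) + 2 * u i := by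
    have hi := congrFun h i
    simp only [sixConf] at hi
    have := hu.two_mul_le i
    have := hv.two_mul_le i
    omega
  have e3 := eqn 3
  have e2 := eqn 2
  have e1 := eqn 1
  have e0 := eqn 0
  have e1' := eqn (-1)
  norm_num [hu.1 3, hv.1 3, hu.1 4, hv.1 4] at e3 e2 e1 e0 e1'
  funext i
  rcases int_mem_window_or_outside i with rfl | rfl | rfl | rfl | rfl | hi
  any_goals omega
  rw [hu.1 i hi, hv.1 i hi]

end SixOdometer

theorem sixConf_zero : sixConf 0 = fun i => if i = 0 then 6 else 0 := by
  funext i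
  simp [sixConf]

theorem lfire_sixConf {u : ℤ → ℕ} (hu : SixOdometer u) (k : ℤ) :
    lfire (sixConf u) k = sixConf (u + Pi.single k 1) := by
  funext i
  have := hu.two_mul_le i
  simp only [lfire, sixConf, Pi.add_apply, Pi.single_apply]
  by_cases hik : i = k
  · subst hik
    simp
    omega
  · by_cases h₁ : i = k - 1
    · subst h₁
      have hne : k - 1 - 1 ≠ k := by omega
      simp [hne] at *
      omega
    · by_cases h₂ : i = k + 1
      · subst h₂
        have hne : k + 1 + 1 ≠ k := by omega
        simp [hne] at *
        omega
      · have h₃ : i - 1 ≠ k := by omega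
        have h₄ : i + 1 ≠ k := by omega
        simp [hik, h₁, h₂, h₃, h₄]

theorem two_le_sixConf {u : ℤ → ℕ} {k : ℤ} (h : SixOdometer (u + Pi.single k 1)) :
    2 ≤ sixConf u k := by
  have hk := h.two_mul_le k
  simp at hk
  simp only [sixConf]
  omega

theorem lLegal_append {c : ℤ → ℕ} {s t : List ℤ} :
    LLegal c (s ++ t) ↔ LLegal c s ∧ LLegal (lapply c s) t := by
  induction s generalizing c with
  | nil => simp [LLegal, lapply]
  | cons k s ih => simp [LLegal, lapply, ih, and_assoc]

theorem lapply_append (c : ℤ → ℕ) (s t : List ℤ) :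
    lapply c (s ++ t) = lapply (lapply c s) t := by
  induction s generalizing c with
  | nil => rfl
  | cons k s ih => exact ih _

theorem LReachable.refl (c : ℤ → ℕ) : LReachable c c :=
  ⟨[], trivial, rfl⟩

theorem LReachable.trans {a b c : ℤ → ℕ} (h₁ : LReachable a b) (h₂ : LReachable b c) :
    LReachable a c := by
  obtain ⟨s, hs, rfl⟩ := h₁
  obtain ⟨t, ht, rfl⟩ := h₂
  exact ⟨s ++ t, lLegal_append.2 ⟨hs, ht⟩, lapply_append _ _ _⟩

theorem LReachable.lfire {c : ℤ → ℕ} {k : ℤ} (h : 2 ≤ c k) : LReachable c (lfire c k) :=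
  ⟨[k], ⟨h, trivial⟩, rfl⟩

theorem lReachable_sixConf_add_single {u : ℤ → ℕ} {k : ℤ} (hu : SixOdometer u)
    (h : SixOdometer (u + Pi.single k 1)) :
    LReachable (sixConf u) (sixConf (u + Pi.single k 1)) :=
  lfire_sixConf hu k ▸ LReachable.lfire (two_le_sixConf h)

theorem lReachable_sixConf_sup {u v : ℤ → ℕ} (hu : SixOdometer u) (hv : SixOdometer v) :
    LReachable (sixConf u) (sixConf (u ⊔ v)) := by
  induction hn : v (-2) + v (-1) + v 0 + v 1 + v 2 using Nat.strong_induction_on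
    generalizing v with
  | _ n ih =>
    rcases eq_or_ne v 0 with rfl | hne
    · have h0 : u ⊔ 0 = u := sup_eq_left.2 fun i => Nat.zero_le _
      rw [h0]
      exact LReachable.refl _
    · obtain ⟨w, k, hw, rfl⟩ := hv.exists_eq_add_single hne
      have hlt : w (-2) + w (-1) + w 0 + w 1 + w 2 < n := by
        rcases int_mem_window_or_outside k with rfl | rfl | rfl | rfl | rfl | hk
        any_goals simp [Pi.single_apply] at hn; omega
        have := hv.1 k hk
        simp at this
      have hreach := ih _ hlt hw rfl
      by_cases hk : u k ≤ w k
      · have hsup : u ⊔ (w + Pi.single k 1) = u ⊔ w + Pi.single k 1 := by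
          funext i
          by_cases hi : i = k
          · subst hi
            simp
            omega
          · simp [hi]
        have hfire := hu.sup hv
        rw [hsup] at hfire ⊢
        exact hreach.trans (lReachable_sixConf_add_single (hu.sup hw) hfire)
      · have hsup : u ⊔ (w + Pi.single k 1) = u ⊔ w := by
          funext i
          by_cases hi : i = k
          · subst hi
            simp
            omega
          · simp [hi]
        rwa [hsup]

theorem exists_sixOdometer_of_lReachable {u c : ℤ → ℕ} (hu : SixOdometer u)
    (h : LReachable (sixConf u) c) : ∃ v, SixOdometer v ∧ u ≤ v ∧ sixConf v = c := by
  obtain ⟨s, hs, rfl⟩ := h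
  induction s generalizing u with
  | nil => exact ⟨u, hu, le_rfl, rfl⟩
  | cons k s ih =>
    obtain ⟨hk, hs⟩ := hs
    rw [lfire_sixConf hu] at hs
    obtain ⟨v, hv, hle, hc⟩ := ih (hu.add_single hk) hs
    refine ⟨v, hv, le_trans (fun i => Nat.le_add_right _ _) hle, ?_⟩
    rw [hc, lapply, lfire_sixConf hu]

theorem lReachable_sixConf_iff {u v : ℤ → ℕ} (hu : SixOdometer u) (hv : SixOdometer v) :
    LReachable (sixConf u) (sixConf v) ↔ u ≤ v := by
  constructor
  · intro h
    obtain ⟨w, hw, hle, hc⟩ := exists_sixOdometer_of_lReachable hu h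
    rwa [← hw.eq_of_sixConf_eq hv hc]
  · intro h
    simpa [sup_eq_right.2 h] using lReachable_sixConf_sup hu hv

theorem lReachable_sixConf_zero_iff {c : ℤ → ℕ} :
    LReachable (sixConf 0) c ↔ ∃ u, SixOdometer u ∧ sixConf u = c := by
  constructor
  · intro h
    obtain ⟨u, hu, -, hc⟩ := exists_sixOdometer_of_lReachable SixOdometer.zero h
    exact ⟨u, hu, hc⟩
  · rintro ⟨u, hu, rfl⟩
    exact (lReachable_sixConf_iff SixOdometer.zero hu).2 fun i => Nat.zero_le _

theorem lIsJoin_sixConf_iff {u v : ℤ → ℕ} {j : ℤ → ℕ} (hu : SixOdometer u)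
    (hv : SixOdometer v) :
    LIsJoin (sixConf 0) (sixConf u) (sixConf v) j ↔ j = sixConf (u ⊓ v) := by
  have huv := hu.inf hv
  constructor
  · rintro ⟨hj, hju, hjv, hmin⟩
    obtain ⟨w, hw, rfl⟩ := lReachable_sixConf_zero_iff.1 hj
    rw [lReachable_sixConf_iff hw hu] at hju
    rw [lReachable_sixConf_iff hw hv] at hjv
    have := hmin _ (lReachable_sixConf_zero_iff.2 ⟨_, huv, rfl⟩)
      ((lReachable_sixConf_iff huv hu).2 inf_le_left)
      ((lReachable_sixConf_iff huv hv).2 inf_le_right)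
    rw [lReachable_sixConf_iff huv hw] at this
    rw [le_antisymm this (le_inf hju hjv)]
  · rintro rfl
    refine ⟨lReachable_sixConf_zero_iff.2 ⟨_, huv, rfl⟩,
      (lReachable_sixConf_iff huv hu).2 inf_le_left,
      (lReachable_sixConf_iff huv hv).2 inf_le_right, fun c hc hcu hcv => ?_⟩
    obtain ⟨w, hw, rfl⟩ := lReachable_sixConf_zero_iff.1 hc
    rw [lReachable_sixConf_iff hw hu] at hcu
    rw [lReachable_sixConf_iff hw hv] at hcv
    exact (lReachable_sixConf_iff hw huv).2 (le_inf hcu hcv)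

theorem lIsMeet_sixConf_iff {u v : ℤ → ℕ} {m : ℤ → ℕ} (hu : SixOdometer u)
    (hv : SixOdometer v) :
    LIsMeet (sixConf 0) (sixConf u) (sixConf v) m ↔ m = sixConf (u ⊔ v) := by
  have huv := hu.sup hv
  constructor
  · rintro ⟨hm, hum, hvm, hmax⟩
    obtain ⟨w, hw, rfl⟩ := lReachable_sixConf_zero_iff.1 hm
    rw [lReachable_sixConf_iff hu hw] at hum
    rw [lReachable_sixConf_iff hv hw] at hvm
    have := hmax _ (lReachable_sixConf_zero_iff.2 ⟨_, huv, rfl⟩)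
      ((lReachable_sixConf_iff hu huv).2 le_sup_left)
      ((lReachable_sixConf_iff hv huv).2 le_sup_right)
    rw [lReachable_sixConf_iff hw huv] at this
    rw [le_antisymm this (sup_le hum hvm)]
  · rintro rfl
    refine ⟨lReachable_sixConf_zero_iff.2 ⟨_, huv, rfl⟩,
      (lReachable_sixConf_iff hu huv).2 le_sup_left,
      (lReachable_sixConf_iff hv huv).2 le_sup_right, fun c hc huc hvc => ?_⟩
    obtain ⟨w, hw, rfl⟩ := lReachable_sixConf_zero_iff.1 hc
    rw [lReachable_sixConf_iff hu hw] at huc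
    rw [lReachable_sixConf_iff hv hw] at hvc
    exact (lReachable_sixConf_iff huv hw).2 (sup_le huc hvc)

/-- For chip-firing on the line starting with 6 chips at the origin,
the configuration poset is a distributive lattice. -/
theorem six_chips_distributive
    (c₀ : ℤ → ℕ) (hc₀ : c₀ = fun i => if i = 0 then 6 else 0) :
    (∀ a b : ℤ → ℕ, LReachable c₀ a → LReachable c₀ b →
      (∃ j, LIsJoin c₀ a b j) ∧ (∃ mt, LIsMeet c₀ a b mt)) ∧
    (∀ x y z yz xyz xy xz w : ℤ → ℕ,
      LReachable c₀ x → LReachable c₀ y → LReachable c₀ z →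
      LIsJoin c₀ y z yz →      -- yz = y ∨ z
      LIsMeet c₀ x yz xyz →    -- xyz = x ∧ (y ∨ z)
      LIsMeet c₀ x y xy →      -- xy = x ∧ y
      LIsMeet c₀ x z xz →      -- xz = x ∧ z
      LIsJoin c₀ xy xz w →     -- w = (x ∧ y) ∨ (x ∧ z)
      xyz = w) := by
  rw [← sixConf_zero] at hc₀
  subst hc₀
  constructor
  · intro a b ha hb
    obtain ⟨u, hu, rfl⟩ := lReachable_sixConf_zero_iff.1 ha
    obtain ⟨v, hv, rfl⟩ := lReachable_sixConf_zero_iff.1 hb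
    exact ⟨⟨_, (lIsJoin_sixConf_iff hu hv).2 rfl⟩, ⟨_, (lIsMeet_sixConf_iff hu hv).2 rfl⟩⟩
  · intro x y z yz xyz xy xz w hx hy hz hyz hxyz hxy hxz hw
    obtain ⟨p, hp, rfl⟩ := lReachable_sixConf_zero_iff.1 hx
    obtain ⟨q, hq, rfl⟩ := lReachable_sixConf_zero_iff.1 hy
    obtain ⟨r, hr, rfl⟩ := lReachable_sixConf_zero_iff.1 hz
    obtain rfl := (lIsJoin_sixConf_iff hq hr).1 hyz
    obtain rfl := (lIsMeet_sixConf_iff hp (hq.inf hr)).1 hxyz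
    obtain rfl := (lIsMeet_sixConf_iff hp hq).1 hxy
    obtain rfl := (lIsMeet_sixConf_iff hp hr).1 hxz
    obtain rfl := (lIsJoin_sixConf_iff (hp.sup hq) (hp.sup hr)).1 hw
    rw [sup_inf_left]
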